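/- arXiv:1507.04373 — 2 statements merged into one kernel-verified Lean document; each statement's English description precedes it below -/
import Mathlib

section
/- Let G be a finite nonabelian group that is characteristically simple (G has no characteristic subgroup other than the trivial subgroup and G itself). If ω(G) ≤ 6, then G is simple. -/
open scoped MatrixGroups

/-- The number of orbits of the natural action of the automorphism group `Aut G`
on the group `G`. -/
noncomputable def omegaAut (G : Type*) [Group G] : ℕ :=
  Nat.card (MulAction.orbitRel.Quotient (MulAut G) G)

theorem card_ne_one_add_one (H : Type*) [Group H] [Finite H] :
    Nat.card {z : H // z ≠ 1} + 1 = Nat.card H := by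
  rw [← Set.ncard_univ H, ← Set.ncard_sdiff_singleton_add_one (Set.mem_univ (1 : H))]
  congr 1
  exact Nat.card_congr (Equiv.subtypeEquivRight fun z => by simp)

section

variable {S : Type*} [Group S] {p q : ℕ} [Fact p.Prime] [Fact q.Prime]

theorem isPGroup_centralizer_singleton (hpq : p ≠ q)
    (hord : ∀ x : S, orderOf x = 1 ∨ orderOf x = p ∨ orderOf x = q) {x : S}
    (hx : orderOf x = p) : IsPGroup p (Subgroup.centralizer {x}) := by
  have hp : p.Prime := Fact.out
  have hq : q.Prime := Fact.out
  refine IsPGroup.iff_orderOf.2 fun ⟨y, hy⟩ => ?_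
  rw [Subgroup.orderOf_mk]
  rcases hord y with h | h | h
  · exact ⟨0, by simpa using h⟩
  · exact ⟨1, by simpa using h⟩
  · exfalso
    have hc : Commute x y := (Subgroup.mem_centralizer_singleton_iff.1 hy).symm
    have hxy := hc.orderOf_mul_eq_mul_orderOf_of_coprime
      (by rw [hx, h]; exact (Nat.coprime_primes hp hq).2 hpq)
    rw [hx, h] at hxy
    rcases hord (x * y) with h' | h' | h' <;> rw [hxy] at h' <;>
      nlinarith [hp.two_le, hq.two_le]

theorem sylow_eq_centralizer_of_mem_center (hpq : p ≠ q)
    (hord : ∀ x : S, orderOf x = 1 ∨ orderOf x = p ∨ orderOf x = q) {P : Sylow p S} {x : P}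
    (hx : x ∈ Subgroup.center P) (hxp : orderOf (x : S) = p) :
    Subgroup.centralizer {(x : S)} = P := by
  refine P.is_maximal' (isPGroup_centralizer_singleton hpq hord hxp) fun y hy => ?_
  rw [Subgroup.mem_centralizer_singleton_iff]
  exact congrArg Subtype.val (Subgroup.mem_center_iff.1 hx ⟨y, hy⟩)

theorem card_orderOf_eq_add_card_sylow [Finite S] (hpq : p ≠ q)
    (hord : ∀ x : S, orderOf x = 1 ∨ orderOf x = p ∨ orderOf x = q)
    (hp : p ∣ Nat.card S)
    (htrans : ∀ x y : S, orderOf x = p → orderOf y = p → ∃ φ : MulAut S, φ x = y)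
    (P : Sylow p S) :
    Nat.card {x : S // orderOf x = p} + Nat.card (Sylow p S) =
      Nat.card (Sylow p S) * Nat.card (Subgroup.center P) := by
  have hp' : p.Prime := Fact.out
  have hq' : q.Prime := Fact.out
  have hordp : ∀ {Q : Sylow p S} (z : Q), z ≠ 1 → orderOf (z : S) = p := by
    intro Q z hz
    rcases hord z with h | h | h
    · exact absurd (Subtype.ext (orderOf_eq_one_iff.1 h)) hz
    · exact h
    · obtain ⟨k, hk⟩ := IsPGroup.iff_orderOf.1 Q.isPGroup' z
      rw [← Subgroup.orderOf_coe, h] at hk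
      exact absurd ((Nat.prime_dvd_prime_iff_eq hq' hp').1
        (hq'.dvd_of_dvd_pow (dvd_of_eq hk))).symm hpq
  obtain ⟨z, hz⟩ : ∃ z : Subgroup.center P, z ≠ 1 := by
    have : Nontrivial P := (Nat.card P).one_lt_iff_ne_zero_and_ne_one.2
      ⟨Nat.card_pos.ne', fun h => hp'.one_lt.ne' (Nat.dvd_one.1 (h ▸ P.dvd_card_of_dvd_card hp))⟩
      |> Finite.one_lt_card_iff_nontrivial.1
    have := P.isPGroup'.center_nontrivial
    exact exists_ne 1
  let f : (Σ Q : Sylow p S, {z : Subgroup.center Q // z ≠ 1}) → {x : S // orderOf x = p} :=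
    fun t => ⟨(t.2.1.1 : S), hordp _ fun h => t.2.2 (Subtype.ext h)⟩
  have hf : Function.Bijective f := by
    constructor
    · rintro ⟨Q, ⟨x, hxQ⟩, hx⟩ ⟨R, ⟨y, hyR⟩, hy⟩ hxy
      have hxy' : (x : S) = y := congrArg Subtype.val hxy
      have hQ := sylow_eq_centralizer_of_mem_center hpq hord hxQ
        (hordp x fun h => hx (Subtype.ext h))
      have hR := sylow_eq_centralizer_of_mem_center hpq hord hyR
        (hordp y fun h => hy (Subtype.ext h))
      obtain rfl : Q = R := Sylow.ext (by rw [← hQ, ← hR, hxy'])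
      obtain rfl : x = y := Subtype.ext hxy'
      rfl
    · rintro ⟨x, hx⟩
      have hzp := hordp z.1 fun h => hz (Subtype.ext h)
      obtain ⟨φ, hφ⟩ := htrans _ _ hzp hx
      have hmem : ∀ y : S, y ∈ (φ • P : Sylow p S) ↔ ∃ w ∈ P, φ w = y := by
        intro y
        rw [← SetLike.mem_coe, ← Sylow.coe_coe, Sylow.pointwise_smul_def]
        exact Iff.rfl
      refine ⟨⟨φ • P, ⟨⟨x, (hmem x).2 ⟨z.1, z.1.2, hφ⟩⟩, ?_⟩, ?_⟩, rfl⟩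
      · rw [Subgroup.mem_center_iff]
        rintro ⟨y, hy⟩
        obtain ⟨w, hw, rfl⟩ := (hmem y).1 hy
        have := congrArg (fun t : P => φ t) (Subgroup.mem_center_iff.1 z.2 ⟨w, hw⟩)
        apply Subtype.ext
        simpa [hφ] using this
      · intro h
        have : x = 1 := congrArg (fun t => (t.1 : S)) h
        rw [this, orderOf_one] at hx
        exact hp'.one_lt.ne hx
  have hcard : ∀ Q : Sylow p S,
      Nat.card {z : Subgroup.center Q // z ≠ 1} + 1 = Nat.card (Subgroup.center P) := fun Q => by
    rw [card_ne_one_add_one]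
    exact Nat.card_congr (Subgroup.centerCongr (Sylow.equiv Q P)).toEquiv
  let _ := Fintype.ofFinite (Sylow p S)
  rw [← Nat.card_congr (Equiv.ofBijective f hf), Nat.card_sigma, Nat.card_eq_fintype_card,
    ← Finset.card_univ, Finset.card_eq_sum_ones, ← Finset.sum_add_distrib,
    Finset.sum_congr rfl fun Q _ => hcard Q, Finset.sum_const, ← Finset.card_eq_sum_ones, smul_eq_mul]

theorem subsingleton_sylow_of_card_orderOf_lt [Finite S] (hpq : p ≠ q)
    (hord : ∀ x : S, orderOf x = 1 ∨ orderOf x = p ∨ orderOf x = q)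
    (P : Sylow p S) (h : Nat.card {x : S // orderOf x = q} < P.index) :
    Subsingleton (Sylow q S) := by
  have hp' : p.Prime := Fact.out
  have hq' : q.Prime := Fact.out
  have hidx : P.index = q ^ P.index.primeFactorsList.length :=
    Nat.eq_prime_pow_of_unique_prime_dvd P.index_ne_zero_of_finite fun {d} hd hdvd => by
      have := Fact.mk hd
      obtain ⟨x, hx⟩ := exists_prime_orderOf_dvd_card' (G := S) d
        (hdvd.trans (Subgroup.index_dvd_card _))
      rcases hord x with h1 | h1 | h1
      · exact absurd (hx.symm.trans h1) hd.one_lt.ne'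
      · obtain rfl : d = p := hx.symm.trans h1
        exact absurd hdvd P.not_dvd_index
      · exact hx.symm.trans h1
  have hQ : ∀ Q : Sylow q S, (Q : Set S) = {x | orderOf x = 1 ∨ orderOf x = q} := by
    intro Q
    refine Set.eq_of_subset_of_ncard_le (fun x hx => ?_) ?_
    · rcases hord x with h1 | h1 | h1
      · exact Or.inl h1
      · obtain ⟨k, hk⟩ := IsPGroup.iff_orderOf.1 Q.isPGroup' ⟨x, hx⟩
        rw [Subgroup.orderOf_mk, h1] at hk
        exact absurd ((Nat.prime_dvd_prime_iff_eq hp' hq').1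
          (hp'.dvd_of_dvd_pow (dvd_of_eq hk))) hpq
      · exact Or.inr h1
    · have h1 : {x : S | orderOf x = 1 ∨ orderOf x = q} = insert 1 {x | orderOf x = q} := by
        ext x; simp
      have h2 : q ^ P.index.primeFactorsList.length ∣ Nat.card Q :=
        Q.pow_dvd_card_of_pow_dvd_card (hidx ▸ Subgroup.index_dvd_card _)
      rw [← hidx] at h2
      calc _ ≤ Set.ncard {x : S | orderOf x = q} + 1 := h1 ▸ Set.ncard_insert_le _ _
        _ ≤ P.index := h
        _ ≤ Nat.card Q := Nat.le_of_dvd Nat.card_pos h2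
  exact ⟨fun Q R => SetLike.coe_injective ((hQ Q).trans (hQ R).symm)⟩

theorem card_sylow_mul_card_center_dvd [Finite S] (P : Sylow p S) :
    Nat.card (Sylow p S) * Nat.card (Subgroup.center P) ∣ Nat.card S := by
  rw [← (P : Subgroup S).index_mul_card]
  exact mul_dvd_mul P.card_dvd_index (Subgroup.card_subgroup_dvd_card _)

theorem card_eq_one_add_card_orderOf [Finite S] (hpq : p ≠ q)
    (hord : ∀ x : S, orderOf x = 1 ∨ orderOf x = p ∨ orderOf x = q) :
    Nat.card S = 1 + Nat.card {x : S // orderOf x = p} + Nat.card {x : S // orderOf x = q} := by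
  have hp' : p.Prime := Fact.out
  have hq' : q.Prime := Fact.out
  have h : (Set.univ : Set S) = {1} ∪ {x | orderOf x = p} ∪ {x | orderOf x = q} := by
    ext x; simpa [or_assoc] using hord x
  rw [← Set.ncard_univ, h, Set.ncard_union_eq, Set.ncard_union_eq, Set.ncard_singleton]
  · rfl
  · simpa using hp'.one_lt.ne
  · rw [Set.disjoint_left]
    rintro x (rfl | hx) hx'
    · exact hq'.one_lt.ne (by simpa using hx')
    · exact hpq (hx.symm.trans hx')

theorem subsingleton_sylow_or_of_transitive [Finite S] (hpq : p ≠ q)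
    (hord : ∀ x : S, orderOf x = 1 ∨ orderOf x = p ∨ orderOf x = q)
    (hp : p ∣ Nat.card S) (hq : q ∣ Nat.card S)
    (hptrans : ∀ x y : S, orderOf x = p → orderOf y = p → ∃ φ : MulAut S, φ x = y)
    (hqtrans : ∀ x y : S, orderOf x = q → orderOf y = q → ∃ φ : MulAut S, φ x = y) :
    Subsingleton (Sylow p S) ∨ Subsingleton (Sylow q S) := by
  have hord' : ∀ x : S, orderOf x = 1 ∨ orderOf x = q ∨ orderOf x = p := fun x => by
    have := hord x; tauto
  obtain ⟨P⟩ : Nonempty (Sylow p S) := inferInstance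
  obtain ⟨Q⟩ : Nonempty (Sylow q S) := inferInstance
  have hP := card_orderOf_eq_add_card_sylow hpq hord hp hptrans P
  have hQ := card_orderOf_eq_add_card_sylow hpq.symm hord' hq hqtrans Q
  have htot := card_eq_one_add_card_orderOf hpq hord
  have hPle := Nat.le_of_dvd (Nat.pos_of_ne_zero P.index_ne_zero_of_finite) P.card_dvd_index
  have hQle := Nat.le_of_dvd (Nat.pos_of_ne_zero Q.index_ne_zero_of_finite) Q.card_dvd_index
  have hnP : 0 < Nat.card (Sylow p S) := Nat.card_pos
  have hnQ : 0 < Nat.card (Sylow q S) := Nat.card_pos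
  have hS : 0 < Nat.card S := Nat.card_pos
  have half : ∀ {m n : ℕ}, m ∣ n → m ≠ n → 0 < n → 2 * m ≤ n := by
    rintro m _ ⟨k, rfl⟩ hne hpos
    have : k ≠ 0 := by rintro rfl; simp at hpos
    have : k ≠ 1 := by rintro rfl; simp at hne
    rw [mul_comm]
    exact Nat.mul_le_mul_left m (by omega)
  by_cases h1 : Nat.card (Sylow p S) * Nat.card (Subgroup.center P) = Nat.card S
  · exact Or.inr (subsingleton_sylow_of_card_orderOf_lt hpq hord P (by omega))
  by_cases h2 : Nat.card (Sylow q S) * Nat.card (Subgroup.center Q) = Nat.card S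
  · exact Or.inl (subsingleton_sylow_of_card_orderOf_lt hpq.symm hord' Q (by omega))
  have h1' := half (card_sylow_mul_card_center_dvd P) h1 hS
  have h2' := half (card_sylow_mul_card_center_dvd Q) h2 hS
  omega

end

section

variable {G : Type*} [Group G] {S : Subgroup G}

theorem map_mulAut_eq_or_disjoint [Finite G] [S.Normal]
    (hmin : ∀ N : Subgroup G, N.Normal → N ≤ S → N = ⊥ ∨ N = S) (φ : MulAut G) :
    S.map φ.toMonoidHom = S ∨ Disjoint (S.map φ.toMonoidHom) S := by
  have hn : (S.map φ.toMonoidHom).Normal := Subgroup.Normal.map ‹_› _ φ.surjective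
  rcases hmin (S.map φ.toMonoidHom ⊓ S) inferInstance inf_le_right with h | h
  · exact Or.inr (disjoint_iff.2 h)
  · refine Or.inl (Subgroup.eq_of_le_of_card_ge (inf_eq_right.1 h) ?_).symm
    exact (Nat.card_congr (φ.subgroupMap S).toEquiv).ge

theorem map_mulAut_eq_of_mem [Finite G] [S.Normal]
    (hmin : ∀ N : Subgroup G, N.Normal → N ≤ S → N = ⊥ ∨ N = S) {φ : MulAut G} {x : G}
    (hx : x ∈ S) (hφ : φ x ∈ S) (hne : x ≠ 1) : S.map φ.toMonoidHom = S := by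
  refine (map_mulAut_eq_or_disjoint hmin φ).resolve_right fun hd => hne ?_
  have : φ x = 1 := Subgroup.disjoint_def.1 hd ⟨x, hx, rfl⟩ hφ
  simpa using this

theorem exists_mulAut_subgroup_apply_eq [Finite G] [S.Normal]
    (hmin : ∀ N : Subgroup G, N.Normal → N ≤ S → N = ⊥ ∨ N = S) {x y : S} (hne : x ≠ 1)
    (φ : MulAut G) (hφ : φ x = y) : ∃ ψ : MulAut S, ψ x = y := by
  have h := map_mulAut_eq_of_mem hmin (φ := φ) x.2 (hφ ▸ y.2) fun h => hne (Subtype.ext h)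
  exact ⟨(φ.subgroupMap S).trans (MulEquiv.subgroupCongr h), Subtype.ext hφ⟩

theorem disjoint_centralizer_of_minimal [Finite G] [S.Normal]
    (hna : ¬ ∀ a b : G, a * b = b * a)
    (hcs : ∀ N : Subgroup G, N.Characteristic → N = ⊥ ∨ N = ⊤) (hbot : S ≠ ⊥)
    (hmin : ∀ N : Subgroup G, N.Normal → N ≤ S → N = ⊥ ∨ N = S) :
    Disjoint S (Subgroup.centralizer S) := by
  rw [disjoint_iff]
  refine (hmin (S ⊓ Subgroup.centralizer S) inferInstance inf_le_left).resolve_right fun h => hna ?_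
  have hab : S ≤ Subgroup.centralizer S := inf_eq_left.1 h
  have hle : ∀ φ : MulAut G, S.map φ.toMonoidHom ≤ Subgroup.centralizer S := fun φ => by
    rcases map_mulAut_eq_or_disjoint hmin φ with h' | h'
    · rwa [h']
    · have hn : (S.map φ.toMonoidHom).Normal := Subgroup.Normal.map ‹_› _ φ.surjective
      exact fun x hx => Subgroup.mem_centralizer_iff.2 fun y hy =>
        (Subgroup.commute_of_normal_of_disjoint _ _ hn ‹_› h' x y hx hy).symm
  have hchar : (⨆ φ : MulAut G, S.map φ.toMonoidHom).Characteristic := by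
    refine Subgroup.characteristic_iff_map_le.2 fun ψ => ?_
    rw [Subgroup.map_iSup]
    refine iSup_le fun φ => ?_
    rw [Subgroup.map_map]
    exact le_iSup (fun φ : MulAut G => S.map φ.toMonoidHom) (φ.trans ψ)
  have hS : S ≤ ⨆ φ : MulAut G, S.map φ.toMonoidHom :=
    le_iSup_of_le 1 fun x hx => ⟨x, hx, rfl⟩
  have htop := (hcs _ hchar).resolve_left fun h' => hbot (le_bot_iff.1 (h' ▸ hS))
  have hcent : Subgroup.centralizer (S : Set G) = ⊤ := top_le_iff.1 (htop ▸ iSup_le hle)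
  have hSc : S ≤ Subgroup.center G := Subgroup.centralizer_eq_top_iff_subset.1 hcent
  have hctop := (hcs _ Subgroup.centerCharacteristic).resolve_left fun h' =>
    hbot (le_bot_iff.1 (h' ▸ hSc))
  exact fun a b => Subgroup.mem_center_iff.1 (hctop ▸ Subgroup.mem_top b) a

theorem mulAut_mul_notMem [Finite G] [S.Normal]
    (hmin : ∀ N : Subgroup G, N.Normal → N ≤ S → N = ⊥ ∨ N = S)
    (hcent : Disjoint S (Subgroup.centralizer S)) {φ : MulAut G}
    (hφ : Disjoint (S.map φ.toMonoidHom) S) {a b : G} (ha : a ∈ S) (hb : b ∈ S)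
    (ha1 : a ≠ 1) (hb1 : b ≠ 1) (ψ : MulAut G) : ψ (a * φ b) ∉ S := by
  have hcases : ∀ (θ : MulAut G) {x : G}, x ∈ S → θ x ∈ S ∨ θ x ∈ Subgroup.centralizer S := by
    intro θ x hx
    have hxm : θ x ∈ S.map θ.toMonoidHom := ⟨x, hx, rfl⟩
    rcases map_mulAut_eq_or_disjoint hmin θ with h | h
    · exact Or.inl (h ▸ hxm)
    · have hn : (S.map θ.toMonoidHom).Normal := Subgroup.Normal.map ‹_› _ θ.surjective
      exact Or.inr <| Subgroup.mem_centralizer_iff.2 fun y hy =>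
        (Subgroup.commute_of_normal_of_disjoint _ _ hn ‹_› h _ y hxm hy).symm
  have hone : ∀ {x : G}, x ∈ S → x ∈ Subgroup.centralizer (S : Set G) → x = 1 :=
    fun h1 h2 => Subgroup.disjoint_def.1 hcent h1 h2
  have hne : ∀ {x : G}, x ∈ S → φ x ∈ S → x = 1 := fun {x} h1 h2 => by
    simpa using Subgroup.disjoint_def.1 hφ ⟨x, h1, rfl⟩ h2
  intro hmem
  rw [map_mul] at hmem
  rcases hcases ψ ha with h1 | h1 <;>
    rcases hcases (ψ * φ) hb with h2 | h2 <;> rw [MulAut.mul_apply] at h2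
  · have e1 := map_mulAut_eq_of_mem hmin ha h1 ha1
    obtain ⟨c, hc, hcb⟩ : ψ (φ b) ∈ S.map ψ.toMonoidHom := e1.symm ▸ h2
    have : c = φ b := ψ.injective hcb
    exact hb1 (hne hb (this ▸ hc))
  · have := hone ((Subgroup.mul_mem_cancel_left _ h1).1 hmem) h2
    exact hb1 (by simpa using this)
  · have := hone ((Subgroup.mul_mem_cancel_right _ h2).1 hmem) h1
    exact ha1 (by simpa using this)
  · have h3 : a * φ b = 1 := by
      have h4 := hone hmem (mul_mem h1 h2)
      rwa [← map_mul, EmbeddingLike.map_eq_one_iff] at h4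
    have h4 : φ b ∈ S := by
      rw [← inv_eq_of_mul_eq_one_right h3]
      exact inv_mem ha
    exact hb1 (hne hb h4)

theorem exists_prime_ne_dvd_card_of_center_eq_bot {H : Type*} [Group H] [Finite H] [Nontrivial H]
    (hc : Subgroup.center H = ⊥) (p : ℕ) [Fact p.Prime] :
    ∃ q, q.Prime ∧ q ≠ p ∧ q ∣ Nat.card H := by
  by_contra! hcon
  have : IsPGroup p H := IsPGroup.of_card <|
    Nat.eq_prime_pow_of_unique_prime_dvd Nat.card_pos.ne' fun {d} hd hdvd => by
      by_contra hne
      exact hcon d hd hne hdvd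
  have := this.center_nontrivial
  exact (Subgroup.nontrivial_iff_ne_bot _).1 this hc

theorem not_subsingleton_sylow_of_minimal [Finite G] [S.Normal] [Nontrivial S]
    (hmin : ∀ N : Subgroup G, N.Normal → N ≤ S → N = ⊥ ∨ N = S)
    (hc : Subgroup.center S = ⊥) {p : ℕ} [Fact p.Prime] (hp : p ∣ Nat.card S) :
    ¬ Subsingleton (Sylow p S) := by
  intro hsub
  obtain ⟨P⟩ : Nonempty (Sylow p S) := inferInstance
  have hchar : (P : Subgroup S).Characteristic := inferInstance
  rcases hmin ((P : Subgroup S).map S.subtype) inferInstance (Subgroup.map_subtype_le _) with h | h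
  · rw [Subgroup.map_eq_bot_iff_of_injective _ S.subtype_injective] at h
    have := P.dvd_card_of_dvd_card hp
    rw [h, Subgroup.card_bot] at this
    exact (Fact.out : p.Prime).one_lt.ne' (Nat.dvd_one.1 this)
  · have htop : (P : Subgroup S) = ⊤ := by
      rw [← Subgroup.map_subtype_inj, h, ← MonoidHom.range_eq_map, Subgroup.range_subtype]
    have : IsPGroup p S := by
      have := P.isPGroup'
      rw [htop] at this
      exact this.of_equiv Subgroup.topEquiv
    have := this.center_nontrivial
    exact (Subgroup.nontrivial_iff_ne_bot _).1 this hc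

theorem exists_mem_not_conj_of_minimal [Finite G] [S.Normal]
    (hmin : ∀ N : Subgroup G, N.Normal → N ≤ S → N = ⊥ ∨ N = S)
    (hc : Subgroup.center S = ⊥) {p q : ℕ} [Fact p.Prime] [Fact q.Prime] (hpq : p ≠ q)
    {a b : S} (ha : orderOf a = p) (hb : orderOf b = q) :
    ∃ c ∈ S, c ≠ 1 ∧ (∀ φ : MulAut G, φ a ≠ c) ∧ ∀ φ : MulAut G, φ b ≠ c := by
  by_contra! hcon
  have hpS : p ∣ Nat.card S := ha ▸ orderOf_dvd_natCard a
  have hqS : q ∣ Nat.card S := hb ▸ orderOf_dvd_natCard b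
  have ha1 : a ≠ 1 := by rintro rfl; simp at ha; exact (Fact.out : p.Prime).one_lt.ne ha
  have hb1 : b ≠ 1 := by rintro rfl; simp at hb; exact (Fact.out : q.Prime).one_lt.ne hb
  have : Nontrivial S := ⟨⟨a, 1, ha1⟩⟩
  have key : ∀ x : S, x = 1 ∨ (∃ φ : MulAut S, φ a = x) ∨ ∃ φ : MulAut S, φ b = x := by
    intro x
    by_cases hx : x = 1
    · exact Or.inl hx
    by_cases h : ∃ φ : MulAut G, φ a = x
    · obtain ⟨φ, hφ⟩ := h
      exact Or.inr (Or.inl (exists_mulAut_subgroup_apply_eq hmin ha1 φ hφ))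
    · obtain ⟨φ, hφ⟩ := hcon x x.2 (fun h => hx (Subtype.ext h)) (not_exists.1 h)
      exact Or.inr (Or.inr (exists_mulAut_subgroup_apply_eq hmin hb1 φ hφ))
  have hord : ∀ x : S, orderOf x = 1 ∨ orderOf x = p ∨ orderOf x = q := by
    intro x
    rcases key x with rfl | ⟨φ, rfl⟩ | ⟨φ, rfl⟩
    · simp
    · exact Or.inr (Or.inl ((MulEquiv.orderOf_eq φ a).trans ha))
    · exact Or.inr (Or.inr ((MulEquiv.orderOf_eq φ b).trans hb))
  have ha' : ∀ x : S, orderOf x = p → ∃ φ : MulAut S, φ a = x := by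
    intro x hx
    rcases key x with rfl | h | ⟨φ, rfl⟩
    · rw [orderOf_one] at hx
      exact absurd hx (Fact.out : p.Prime).one_lt.ne
    · exact h
    · exact absurd (hx.symm.trans ((MulEquiv.orderOf_eq φ b).trans hb)) hpq
  have hb' : ∀ x : S, orderOf x = q → ∃ φ : MulAut S, φ b = x := by
    intro x hx
    rcases key x with rfl | ⟨φ, rfl⟩ | h
    · rw [orderOf_one] at hx
      exact absurd hx (Fact.out : q.Prime).one_lt.ne
    · exact absurd (((MulEquiv.orderOf_eq φ a).trans ha).symm.trans hx) hpq
    · exact h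
  have trans_of : ∀ {c x y : S}, (∃ φ : MulAut S, φ c = x) → (∃ φ : MulAut S, φ c = y) →
      ∃ φ : MulAut S, φ x = y := by
    rintro c _ _ ⟨φ, rfl⟩ ⟨ψ, rfl⟩
    exact ⟨ψ * φ⁻¹, by simp [MulAut.mul_apply]⟩
  rcases subsingleton_sylow_or_of_transitive hpq hord hpS hqS
      (fun x y hx hy => trans_of (ha' x hx) (ha' y hy))
      (fun x y hx hy => trans_of (hb' x hx) (hb' y hy)) with h | h
  · exact not_subsingleton_sylow_of_minimal hmin hc hpS h
  · exact not_subsingleton_sylow_of_minimal hmin hc hqS h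

theorem length_le_omegaAut [Finite G] (l : List G)
    (hl : l.Pairwise fun x y => ∀ φ : MulAut G, φ x ≠ y) : l.length ≤ omegaAut G := by
  have hnd : (l.map (Quotient.mk (MulAction.orbitRel (MulAut G) G))).Nodup := by
    rw [List.Nodup, List.pairwise_map]
    refine hl.imp fun {x y} h he => ?_
    obtain ⟨φ, hφ⟩ := MulAction.orbitRel_apply.1 (Quotient.exact he.symm)
    exact h φ hφ
  let _ := Fintype.ofFinite (MulAction.orbitRel.Quotient (MulAut G) G)
  simpa [omegaAut, Nat.card_eq_fintype_card] using hnd.length_le_card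

theorem seven_le_omegaAut [Finite G] [S.Normal]
    (hmin : ∀ N : Subgroup G, N.Normal → N ≤ S → N = ⊥ ∨ N = S)
    (hbot : S ≠ ⊥) (hcent : Disjoint S (Subgroup.centralizer S)) {φ : MulAut G}
    (hφ : Disjoint (S.map φ.toMonoidHom) S) : 7 ≤ omegaAut G := by
  have : Nontrivial S := (Subgroup.nontrivial_iff_ne_bot S).2 hbot
  have hc : Subgroup.center S = ⊥ := (Subgroup.eq_bot_iff_forall _).2 fun x hx =>
    Subtype.ext <| Subgroup.disjoint_def.1 hcent x.2 <| Subgroup.mem_centralizer_iff.2 fun y hy =>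
      congrArg Subtype.val (Subgroup.mem_center_iff.1 hx ⟨y, hy⟩)
  obtain ⟨p, hp, hpS⟩ := Nat.exists_prime_and_dvd
    (Finite.one_lt_card_iff_nontrivial.2 ‹Nontrivial S›).ne'
  have := Fact.mk hp
  obtain ⟨q, hq, hqp, hqS⟩ := exists_prime_ne_dvd_card_of_center_eq_bot hc p
  have := Fact.mk hq
  obtain ⟨a, ha⟩ := exists_prime_orderOf_dvd_card' (G := S) p hpS
  obtain ⟨b, hb⟩ := exists_prime_orderOf_dvd_card' (G := S) q hqS
  obtain ⟨c, hcS, hc1, hca, hcb⟩ := exists_mem_not_conj_of_minimal hmin hc hqp.symm ha hb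
  obtain ⟨a, haS⟩ := a
  obtain ⟨b, hbS⟩ := b
  rw [Subgroup.orderOf_mk] at ha hb
  have ha1 : a ≠ 1 := fun h => hp.one_lt.ne (by rw [← ha, h, orderOf_one])
  have hb1 : b ≠ 1 := fun h => hq.one_lt.ne (by rw [← hb, h, orderOf_one])
  have hn : (S.map φ.toMonoidHom).Normal := Subgroup.Normal.map ‹_› _ φ.surjective
  have hcomm : ∀ {x y : G}, x ∈ S → y ∈ S → Commute x (φ y) := fun hx hy =>
    Subgroup.commute_of_normal_of_disjoint _ _ ‹_› hn hφ.symm _ _ hx ⟨_, hy, rfl⟩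
  have hpow : ∀ {x y : G} {n : ℕ}, x ∈ S → y ∈ S → x ^ n = 1 → y ^ n = 1 →
      (x * φ y) ^ n = 1 := fun hx hy h1 h2 => by
    rw [(hcomm hx hy).mul_pow, ← map_pow, h1, h2, map_one, one_mul]
  have hmix : ∀ {x y z : G}, x ∈ S → y ∈ S → z ∈ S → x ≠ 1 → y ≠ 1 → ∀ ψ : MulAut G,
      ψ z ≠ x * φ y := fun {x y z} hx hy hz hx1 hy1 ψ h =>
    mulAut_mul_notMem hmin hcent hφ hx hy hx1 hy1 ψ⁻¹ (by rw [← h]; simpa using hz)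
  have hneOrd : ∀ {x y : G}, orderOf x ≠ orderOf y → ∀ ψ : MulAut G, ψ x ≠ y :=
    fun hxy ψ h => hxy (by rw [← h]; exact (MulEquiv.orderOf_eq ψ _).symm)
  have ne_one : ∀ {x y : G}, x ∈ S → y ∈ S → x ≠ 1 → y ≠ 1 → x * φ y ≠ 1 :=
    fun hx hy hx1 hy1 h => hmix hx hy S.one_mem hx1 hy1 1 (by simpa using h.symm)
  have haa : orderOf (a * φ a) = p := orderOf_eq_prime
    (hpow haS haS (ha ▸ pow_orderOf_eq_one a) (ha ▸ pow_orderOf_eq_one a)) (ne_one haS haS ha1 ha1)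
  have hbb : orderOf (b * φ b) = q := orderOf_eq_prime
    (hpow hbS hbS (hb ▸ pow_orderOf_eq_one b) (hb ▸ pow_orderOf_eq_one b)) (ne_one hbS hbS hb1 hb1)
  have hφb : orderOf (φ b) = q := (MulEquiv.orderOf_eq φ b).trans hb
  have hab : orderOf (a * φ b) = p * q := by
    rw [(hcomm haS hbS).orderOf_mul_eq_mul_orderOf_of_coprime, ha, hφb]
    rw [ha, hφb]
    exact (Nat.coprime_primes hp hq).2 hqp.symm
  have hone : ∀ {x : G}, x ≠ 1 → ∀ ψ : MulAut G, ψ 1 ≠ x := fun hx ψ h => hx (by simpa using h.symm)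
  have hppq : p ≠ p * q := by nlinarith [hp.two_le, hq.two_le]
  have hpqq : p * q ≠ q := by nlinarith [hp.two_le, hq.two_le]
  refine length_le_omegaAut [1, a, b, c, a * φ a, a * φ b, b * φ b] ?_
  simp only [List.pairwise_cons, List.mem_cons, List.not_mem_nil, or_false, forall_eq_or_imp,
    forall_eq, IsEmpty.forall_iff, implies_true, List.Pairwise.nil, and_true]
  have hS : ∀ {z : G}, z ∈ S → (∀ ψ : MulAut G, ψ z ≠ a * φ a) ∧
      (∀ ψ : MulAut G, ψ z ≠ a * φ b) ∧ ∀ ψ : MulAut G, ψ z ≠ b * φ b := fun hz =>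
    ⟨hmix haS haS hz ha1 ha1, hmix haS hbS hz ha1 hb1, hmix hbS hbS hz hb1 hb1⟩
  exact ⟨⟨hone ha1, hone hb1, hone hc1, hS S.one_mem⟩,
    ⟨hneOrd (by rw [ha, hb]; exact hqp.symm), hca, hS haS⟩, ⟨hcb, hS hbS⟩, hS hcS,
    ⟨hneOrd (by rwa [haa, hab]), hneOrd (by rw [haa, hbb]; exact hqp.symm)⟩,
    hneOrd (by rwa [hab, hbb])⟩

end

/-- A finite nonabelian characteristically simple group with at most 6 automorphism
orbits is simple. -/
theorem stmt_3 (G : Type*) [Group G] [Finite G]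
    (hna : ¬ ∀ a b : G, a * b = b * a)
    (hcs : ∀ N : Subgroup G, N.Characteristic → N = ⊥ ∨ N = ⊤)
    (h : omegaAut G ≤ 6) :
    IsSimpleGroup G := by
  have hG : Nontrivial G := by
    by_contra hG
    rw [not_nontrivial_iff_subsingleton] at hG
    exact hna fun a b => Subsingleton.elim _ _
  obtain ⟨S, -, ⟨hSn, hbot⟩, hS⟩ := exists_minimal_le_of_wellFoundedLT
    (fun N : Subgroup G => N.Normal ∧ N ≠ ⊥) ⊤ ⟨inferInstance, top_ne_bot⟩
  have hmin : ∀ N : Subgroup G, N.Normal → N ≤ S → N = ⊥ ∨ N = S := fun N hN hle =>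
    or_iff_not_imp_left.2 fun hne => le_antisymm hle (hS ⟨hN, hne⟩ hle)
  by_cases hchar : S.Characteristic
  · obtain rfl := (hcs S hchar).resolve_left hbot
    exact ⟨fun N hN => hmin N hN le_top⟩
  · exfalso
    obtain ⟨φ, hφ⟩ : ∃ φ : MulAut G, S.map φ.toMonoidHom ≠ S := by
      by_contra! hall
      exact hchar (Subgroup.characteristic_iff_map_eq.2 hall)
    have := seven_le_omegaAut hmin hbot (disjoint_centralizer_of_minimal hna hcs hbot hmin)
      ((map_mulAut_eq_or_disjoint hmin φ).resolve_left hφ)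
    omega
end

section
/- Let G be a finite nonsolvable group and N a characteristic subgroup of G. Assume that exactly 4 distinct primes divide the order of G, and that N is isomorphic to one of the groups A₅, A₆, PSL(2,7) or PSL(2,8). Then ω(G) ≥ 8. -/
open scoped MatrixGroups

open Subgroup MulAction

section CoprimeAction

variable {p : ℕ} [Fact p.Prime] {A N : Type*} [Group A] [Group N]
  [MulDistribMulAction A N]

/-- A `p`-group acting by automorphisms fixes an element of order `n` as soon as the number
of such elements is prime to `p`. -/
lemma IsPGroup.exists_mem_fixedPoints_orderOf_eq (hA : IsPGroup p A) {n : ℕ}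
    (hn : ¬ p ∣ Nat.card {x : N // orderOf x = n}) :
    ∃ x ∈ FixedPoints.subgroup A N, orderOf x = n := by
  let S : SubMulAction A N :=
    { carrier := {x | orderOf x = n}
      smul_mem' := fun a x hx => by
        simpa using (MulEquiv.orderOf_eq (MulDistribMulAction.toMulEquiv N a) x).trans hx }
  obtain ⟨x, hx⟩ := hA.nonempty_fixed_point_of_prime_not_dvd_card S hn
  exact ⟨x, fun a => congrArg Subtype.val (hx a), x.2⟩

variable [Finite N]

/-- If a `p`-group acts by automorphisms on a group `N` of order prime to `p`, and `p` divides
none of the numbers `r ^ i - 1`, where `r ^ k` is the order of a Sylow `r`-subgroup of `N` and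
`1 ≤ i ≤ k`, then the order of the fixed subgroup is divisible by `r ^ k`. -/
lemma IsPGroup.prime_pow_dvd_card_fixedPoints (hA : IsPGroup p A) (hp : ¬ p ∣ Nat.card N)
    {r k m : ℕ} (hr : r.Prime) (hN : Nat.card N = r ^ k * m) (hm : ¬ r ∣ m)
    (h : ∀ i, 1 ≤ i → i ≤ k → ¬ p ∣ r ^ i - 1) :
    r ^ k ∣ Nat.card (FixedPoints.subgroup A N) := by
  have : Fact r.Prime := ⟨hr⟩
  have hm0 : m ≠ 0 := by rintro rfl; simp at hm
  have hcard (Q : Sylow r N) : Nat.card Q = r ^ k := by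
    rw [Sylow.card_eq_multiplicity, hN,
      Nat.factorization_mul (pow_ne_zero _ hr.ne_zero) hm0, Nat.factorization_pow]
    simp [hr.factorization_self, Nat.factorization_eq_zero_of_not_dvd hm]
  obtain ⟨P, hP⟩ := hA.nonempty_fixed_point_of_prime_not_dvd_card (Sylow r N)
    fun hd => hp (hd.trans ((default : Sylow r N).card_dvd_index.trans (Subgroup.index_dvd_card _)))
  let S : SubMulAction A N :=
    { carrier := P
      smul_mem' := fun a x hx => by
        have := Subgroup.smul_mem_pointwise_smul x a (P : Subgroup N) hx
        rwa [← Sylow.pointwise_smul_def, hP a] at this }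
  have hmod := hA.card_modEq_card_fixedPoints S
  let F : Subgroup N := FixedPoints.subgroup A N ⊓ P
  have hSF : Nat.card (fixedPoints A S) = Nat.card F :=
    Nat.card_congr
      { toFun := fun x => ⟨x.1, fun a => congrArg Subtype.val (x.2 a), x.1.2⟩
        invFun := fun x => ⟨⟨x.1, x.2.2⟩, fun a => Subtype.ext (x.2.1 a)⟩
        left_inv := fun _ => rfl
        right_inv := fun _ => rfl }
  have hS : Nat.card S = r ^ k := hcard P
  obtain ⟨j, hjk, hj⟩ : ∃ j ≤ k, Nat.card F = r ^ j := by
    rw [← Nat.dvd_prime_pow hr, ← hcard P]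
    exact Subgroup.card_dvd_of_le inf_le_right
  rw [hSF, hS, hj] at hmod
  have hjk' : j = k := by
    by_contra hne
    have hlt : j < k := lt_of_le_of_ne hjk hne
    have hd := (Nat.modEq_iff_dvd' (Nat.pow_le_pow_right hr.pos hjk)).1 hmod.symm
    have hfac : r ^ k - r ^ j = r ^ j * (r ^ (k - j) - 1) := by
      rw [Nat.mul_sub, ← pow_add, Nat.add_sub_cancel' hjk, mul_one]
    rw [hfac] at hd
    rcases (Fact.out : p.Prime).dvd_mul.1 hd with hd | hd
    · refine hp ?_
      rw [hN]
      exact (hd.trans (pow_dvd_pow r hjk)).mul_right m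
    · exact h (k - j) (by omega) (by omega) hd
  rw [← hjk', ← hj]
  exact Subgroup.card_dvd_of_le inf_le_left

/-- A `p`-group acting by automorphisms on a group of order `60`, `168` or `504`, with `p` prime
to this order, acts trivially. -/
lemma IsPGroup.fixedPoints_eq_top_of_card (hA : IsPGroup p A) (hp : ¬ p ∣ Nat.card N)
    (hN : Nat.card N = 60 ∨ Nat.card N = 168 ∨ Nat.card N = 504) :
    FixedPoints.subgroup A N = ⊤ := by
  have hp' {d : ℕ} (hd : d ∣ Nat.card N ^ 3) : ¬ p ∣ d := fun h =>
    hp ((Fact.out : p.Prime).dvd_of_dvd_pow (h.trans hd))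
  have key {r : ℕ} (k m : ℕ) (hr : r.Prime) (hN : Nat.card N = r ^ k * m) (hm : ¬ r ∣ m)
      (h : ∀ i, 1 ≤ i → i ≤ k → r ^ i - 1 ∣ Nat.card N ^ 3) :=
    hA.prime_pow_dvd_card_fixedPoints hp hr hN hm fun i h1 h2 => hp' (h i h1 h2)
  have hdvd := (FixedPoints.subgroup A N).card_subgroup_dvd_card
  refine Subgroup.eq_top_of_card_eq _ (Nat.dvd_antisymm hdvd ?_)
  rcases hN with hN | hN | hN <;> rw [hN] at key ⊢
  · have h2 := key (r := 2) 2 15 (by norm_num) (by norm_num) (by norm_num)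
      (by intro i h1 h2; interval_cases i <;> norm_num)
    have h3 := key (r := 3) 1 20 (by norm_num) (by norm_num) (by norm_num)
      (by intro i h1 h2; interval_cases i; norm_num)
    have h5 := key (r := 5) 1 12 (by norm_num) (by norm_num) (by norm_num)
      (by intro i h1 h2; interval_cases i; norm_num)
    omega
  · have h2 := key (r := 2) 3 21 (by norm_num) (by norm_num) (by norm_num)
      (by intro i h1 h2; interval_cases i <;> norm_num)
    have h3 := key (r := 3) 1 56 (by norm_num) (by norm_num) (by norm_num)
      (by intro i h1 h2; interval_cases i; norm_num)
    have h7 := key (r := 7) 1 24 (by norm_num) (by norm_num) (by norm_num)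
      (by intro i h1 h2; interval_cases i; norm_num)
    omega
  · have h2 := key (r := 2) 3 63 (by norm_num) (by norm_num) (by norm_num)
      (by intro i h1 h2; interval_cases i <;> norm_num)
    have h3 := key (r := 3) 2 56 (by norm_num) (by norm_num) (by norm_num)
      (by intro i h1 h2; interval_cases i <;> norm_num)
    have h7 := key (r := 7) 1 72 (by norm_num) (by norm_num) (by norm_num)
      (by intro i h1 h2; interval_cases i; norm_num)
    omega

/-- A `p`-group acting by automorphisms on a group of order `360` with exactly `90` elements of
order `4`, with `p` prime to `360`, acts trivially. -/
lemma IsPGroup.fixedPoints_eq_top_of_card_eq_360 (hA : IsPGroup p A) (hp : ¬ p ∣ Nat.card N)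
    (hN : Nat.card N = 360) (h4 : Nat.card {x : N // orderOf x = 4} = 90) :
    FixedPoints.subgroup A N = ⊤ := by
  have hp' {d : ℕ} (hd : d ∣ Nat.card N ^ 3) : ¬ p ∣ d := fun h =>
    hp ((Fact.out : p.Prime).dvd_of_dvd_pow (h.trans hd))
  have key {r : ℕ} (k m : ℕ) (hr : r.Prime) (hN : Nat.card N = r ^ k * m) (hm : ¬ r ∣ m)
      (h : ∀ i, 1 ≤ i → i ≤ k → r ^ i - 1 ∣ Nat.card N ^ 3) :=
    hA.prime_pow_dvd_card_fixedPoints hp hr hN hm fun i h1 h2 => hp' (h i h1 h2)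
  have hdvd := (FixedPoints.subgroup A N).card_subgroup_dvd_card
  have hmod : Nat.card N ≡ Nat.card (FixedPoints.subgroup A N) [MOD p] :=
    hA.card_modEq_card_fixedPoints N
  obtain ⟨x, hx, hx4⟩ := hA.exists_mem_fixedPoints_orderOf_eq (N := N) (n := 4)
    (by rw [h4]; exact hp' (by rw [hN]; norm_num))
  have h2 : 4 ∣ Nat.card (FixedPoints.subgroup A N) :=
    hx4 ▸ Subgroup.orderOf_dvd_natCard _ hx
  rw [hN] at key hdvd hmod hp'
  have h3 := key (r := 3) 2 40 (by norm_num) (by norm_num) (by norm_num)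
    (by intro i h1 h2; interval_cases i <;> norm_num)
  have h5 := key (r := 5) 1 72 (by norm_num) (by norm_num) (by norm_num)
    (by intro i h1 h2; interval_cases i; norm_num)
  have h180 : Nat.card (FixedPoints.subgroup A N) ≠ 180 := fun h => by
    rw [h] at hmod
    exact hp' (d := 180) (by norm_num) ((Nat.modEq_iff_dvd' (by norm_num)).1 hmod.symm)
  refine Subgroup.eq_top_of_card_eq _ ?_
  rw [hN]
  have hle := Nat.le_of_dvd (by norm_num) hdvd
  have hpos : 0 < Nat.card (FixedPoints.subgroup A N) := Nat.card_pos
  omega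

end CoprimeAction

section Cardinalities

lemma Matrix.SpecialLinearGroup.card_mul_card_units {n : ℕ} {F : Type*} [Field F] [Finite F] :
    Nat.card (Matrix.SpecialLinearGroup (Fin (n + 1)) F) * Nat.card Fˣ
      = Nat.card (GL (Fin (n + 1)) F) := by
  let d : GL (Fin (n + 1)) F →* Fˣ := Matrix.GeneralLinearGroup.det
  have hker : (Matrix.SpecialLinearGroup.toGL (n := Fin (n + 1)) (R := F)).range = d.ker := by
    ext g
    constructor
    · rintro ⟨s, rfl⟩
      exact Units.ext s.2
    · intro hg
      exact ⟨⟨g.1, congrArg Units.val hg⟩, Units.ext rfl⟩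
  rw [d.ker.card_eq_card_quotient_mul_card_subgroup, ← hker, mul_comm,
    Nat.card_congr (MonoidHom.ofInjective Matrix.SpecialLinearGroup.toGL_injective).toEquiv, hker,
    Nat.card_congr (QuotientGroup.quotientKerEquivOfSurjective d
      Matrix.GeneralLinearGroup.det_surjective).toEquiv]

lemma card_PSL_two {F : Type*} [Field F] [Finite F] :
    Nat.card PSL(2, F) * Nat.card (rootsOfUnity 2 F) * (Nat.card F - 1)
      = (Nat.card F ^ 2 - 1) * (Nat.card F ^ 2 - Nat.card F) := by
  have := Fintype.ofFinite F
  have h1 := (Subgroup.center SL(2, F)).card_eq_card_quotient_mul_card_subgroup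
  have h2 : Nat.card (Subgroup.center SL(2, F)) = Nat.card (rootsOfUnity 2 F) :=
    Nat.card_congr (Matrix.SpecialLinearGroup.center_equiv_rootsOfUnity' (0 : Fin 2)).toEquiv
  have h3 := Matrix.SpecialLinearGroup.card_mul_card_units (n := 1) (F := F)
  rw [Matrix.card_GL_field, h1, h2, Nat.card_units] at h3
  simpa [Fin.prod_univ_two, Nat.card_eq_fintype_card] using h3

lemma card_PSL_two_zmod_seven : Nat.card PSL(2, ZMod 7) = 168 := by
  have : Fact (Nat.Prime 7) := ⟨by norm_num⟩
  have h := card_PSL_two (F := ZMod 7)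
  have hr : Nat.card (rootsOfUnity 2 (ZMod 7)) = 2 :=
    (IsPrimitiveRoot.neg_one 7 (by norm_num)).card_rootsOfUnity
  rw [hr, Nat.card_zmod] at h
  omega

lemma card_PSL_two_galoisField_eight : Nat.card PSL(2, GaloisField 2 3) = 504 := by
  have h := card_PSL_two (F := GaloisField 2 3)
  have hr : Nat.card (rootsOfUnity 2 (GaloisField 2 3)) = 1 := by
    rw [Nat.card_eq_one_iff_unique]
    refine ⟨⟨fun a b => ?_⟩, ⟨1⟩⟩
    have hone (c : rootsOfUnity 2 (GaloisField 2 3)) : c = 1 := by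
      have hc : ((c : (GaloisField 2 3)ˣ) : GaloisField 2 3) ^ 2 = 1 := by
        rw [← Units.val_pow_eq_pow_val, (mem_rootsOfUnity _ _).1 c.2, Units.val_one]
      refine Subtype.ext (Units.ext ?_)
      rcases mul_self_eq_one_iff.1 ((sq _).symm.trans hc) with h | h
      · exact h
      · rw [h, CharTwo.neg_eq]; rfl
    rw [hone a, hone b]
  rw [hr, GaloisField.card 2 3 (by norm_num)] at h
  omega

lemma card_alternatingGroup_five : Nat.card (alternatingGroup (Fin 5)) = 60 := by
  have h := two_mul_nat_card_alternatingGroup (α := Fin 5)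
  rw [Nat.card_perm, Nat.card_fin] at h
  simp only [Nat.factorial] at h
  omega

lemma card_alternatingGroup_six : Nat.card (alternatingGroup (Fin 6)) = 360 := by
  have h := two_mul_nat_card_alternatingGroup (α := Fin 6)
  rw [Nat.card_perm, Nat.card_fin] at h
  simp only [Nat.factorial] at h
  omega

lemma card_orderOf_eq_four_alternatingGroup_six :
    Nat.card {x : alternatingGroup (Fin 6) // orderOf x = 4} = 90 := by
  have h (x : alternatingGroup (Fin 6)) : orderOf x = 4 ↔ ¬ x ^ 2 = 1 ∧ x ^ 4 = 1 := by
    refine ⟨fun h => ⟨fun h2 => ?_, h ▸ pow_orderOf_eq_one x⟩, fun ⟨h2, h4⟩ => ?_⟩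
    · have := Nat.le_of_dvd two_pos (orderOf_dvd_of_pow_eq_one h2)
      omega
    · exact orderOf_eq_prime_pow (p := 2) (n := 1) h2 h4
  rw [Nat.card_congr (Equiv.subtypeEquivRight h), Nat.card_eq_fintype_card, Fintype.card_subtype]
  decide +kernel

end Cardinalities

/-- The number of automorphism orbits is at least the number of element orders. -/
lemma card_le_omegaAut {G : Type*} [Group G] [Finite G] (s : Finset ℕ)
    (hs : ∀ n ∈ s, ∃ g : G, orderOf g = n) : s.card ≤ omegaAut G := by
  let f : orbitRel.Quotient (MulAut G) G → ℕ := Quotient.lift orderOf fun a b hab => by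
    obtain ⟨φ, rfl⟩ := hab
    exact φ.orderOf_eq b
  have hsub : (s : Set ℕ) ⊆ Set.range f := fun n hn => by
    obtain ⟨g, hg⟩ := hs n hn
    exact ⟨Quotient.mk _ g, hg⟩
  calc s.card = Nat.card (s : Set ℕ) := by simp
    _ ≤ Nat.card (Set.range f) := Nat.card_mono (Set.finite_range f) hsub
    _ ≤ omegaAut G := Finite.card_range_le f

/-- If an element of prime order `p` centralizes a subgroup `N` of order prime to `p`, then
there are at least `2 * (1 + |π(N)|)` automorphism orbits. -/
lemma two_mul_card_primeFactors_add_one_le_omegaAut {G : Type*} [Group G] [Finite G]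
    (N : Subgroup G) {p : ℕ} (hp : p.Prime) (hpN : ¬ p ∣ Nat.card N) (g : G)
    (hg : orderOf g = p) (hgN : ∀ x ∈ N, Commute g x) :
    2 * ((Nat.card N).primeFactors.card + 1) ≤ omegaAut G := by
  let s : Finset ℕ := insert 1 (Nat.card N).primeFactors
  have hs1 : s.card = (Nat.card N).primeFactors.card + 1 :=
    Finset.card_insert_of_notMem fun h => Nat.not_prime_one (Nat.prime_of_mem_primeFactors h)
  have hs (n : ℕ) (hn : n ∈ s) : n ∣ Nat.card N ∧ ∃ x ∈ N, orderOf x = n := by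
    rcases Finset.mem_insert.1 hn with rfl | hn
    · exact ⟨one_dvd _, 1, N.one_mem, orderOf_one⟩
    · have : Fact n.Prime := ⟨Nat.prime_of_mem_primeFactors hn⟩
      have hd := Nat.dvd_of_mem_primeFactors hn
      obtain ⟨x, hx⟩ := exists_prime_orderOf_dvd_card' n hd
      exact ⟨hd, x, x.2, by rw [Subgroup.orderOf_coe, hx]⟩
  have hdisj : Disjoint s (s.image (p * ·)) := by
    refine Finset.disjoint_left.2 fun n hn hn' => ?_
    obtain ⟨m, -, rfl⟩ := Finset.mem_image.1 hn'
    exact hpN ((dvd_mul_right p m).trans (hs _ hn).1)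
  have hcard : (s ∪ s.image (p * ·)).card = 2 * ((Nat.card N).primeFactors.card + 1) := by
    rw [Finset.card_union_of_disjoint hdisj,
      Finset.card_image_of_injective _ (mul_right_injective₀ hp.ne_zero), hs1, two_mul]
  rw [← hcard]
  refine card_le_omegaAut _ fun n hn => ?_
  rcases Finset.mem_union.1 hn with hn | hn
  · obtain ⟨-, x, -, hx⟩ := hs n hn
    exact ⟨x, hx⟩
  · obtain ⟨m, hm, rfl⟩ := Finset.mem_image.1 hn
    obtain ⟨hd, x, hxN, hx⟩ := hs m hm
    refine ⟨g * x, ?_⟩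
    rw [(hgN x hxN).orderOf_mul_eq_mul_orderOf_of_coprime, hg, hx]
    rw [hg, hx]
    exact (hp.coprime_iff_not_dvd.2 hpN).coprime_dvd_right hd

lemma eight_le_omegaAut_of_fixedPoints_eq_top {G : Type*} [Group G] [Finite G] (N : Subgroup G)
    [N.Normal] (hpi : (Nat.card G).primeFactors.card = 4)
    (hN : (Nat.card N).primeFactors.card = 3)
    (htriv : ∀ (p : ℕ) [Fact p.Prime] (A : Subgroup G) [MulDistribMulAction A N],
      IsPGroup p A → ¬ p ∣ Nat.card N → FixedPoints.subgroup A N = ⊤) :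
    8 ≤ omegaAut G := by
  obtain ⟨p, hpG, hpN⟩ := Finset.exists_mem_notMem_of_card_lt_card
    (s := (Nat.card N).primeFactors) (t := (Nat.card G).primeFactors) (by omega)
  have hp := Nat.prime_of_mem_primeFactors hpG
  have : Fact p.Prime := ⟨hp⟩
  have hpN' : ¬ p ∣ Nat.card N := fun h =>
    hpN (Nat.mem_primeFactors.2 ⟨hp, h, Nat.card_pos.ne'⟩)
  obtain ⟨g, hg⟩ := exists_prime_orderOf_dvd_card' (G := G) p (Nat.dvd_of_mem_primeFactors hpG)
  let act : MulDistribMulAction (zpowers g) N :=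
    MulDistribMulAction.compHom N ((MulAut.conjNormal (H := N)).comp (zpowers g).subtype)
  have hA : IsPGroup p (zpowers g) := IsPGroup.of_card (n := 1) (by simp [hg])
  have htop := htriv p (zpowers g) hA hpN'
  have hcomm : ∀ x ∈ N, Commute g x := fun x hx => by
    have hmem : (⟨x, hx⟩ : N) ∈ FixedPoints.subgroup (zpowers g) N := htop ▸ Subgroup.mem_top _
    have h : g * x * g⁻¹ = x := congrArg Subtype.val (hmem ⟨g, mem_zpowers g⟩)
    exact mul_inv_eq_iff_eq_mul.1 h
  have := two_mul_card_primeFactors_add_one_le_omegaAut N hp hpN' g hg hcomm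
  omega

/-- If `G` is finite nonsolvable, exactly 4 primes divide `|G|`, and `G` has a
characteristic subgroup isomorphic to `A₅`, `A₆`, `PSL(2,7)` or `PSL(2,8)`, then
`G` has at least 8 automorphism orbits. -/
theorem stmt_5 (G : Type*) [Group G] [Finite G] (hns : ¬ IsSolvable G)
    (N : Subgroup G) (hchar : N.Characteristic)
    (hpi : (Nat.card G).primeFactors.card = 4)
    (hiso : Nonempty (N ≃* alternatingGroup (Fin 5)) ∨
            Nonempty (N ≃* alternatingGroup (Fin 6)) ∨
            Nonempty (N ≃* PSL(2, ZMod 7)) ∨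
            Nonempty (N ≃* PSL(2, GaloisField 2 3))) :
    8 ≤ omegaAut G := by
  have := Subgroup.normal_of_characteristic N
  have h60 : Nat.primeFactors 60 = {2, 3, 5} := by decide +kernel
  have h168 : Nat.primeFactors 168 = {2, 3, 7} := by decide +kernel
  have h360 : Nat.primeFactors 360 = {2, 3, 5} := by decide +kernel
  have h504 : Nat.primeFactors 504 = {2, 3, 7} := by decide +kernel
  rcases hiso with ⟨⟨e⟩⟩ | ⟨⟨e⟩⟩ | ⟨⟨e⟩⟩ | ⟨⟨e⟩⟩
  · have hN : Nat.card N = 60 := (Nat.card_congr e.toEquiv).trans card_alternatingGroup_five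
    refine eight_le_omegaAut_of_fixedPoints_eq_top N hpi (by rw [hN, h60]; rfl) ?_
    intro p _ A _ hA hp
    exact hA.fixedPoints_eq_top_of_card hp (.inl hN)
  · have hN : Nat.card N = 360 := (Nat.card_congr e.toEquiv).trans card_alternatingGroup_six
    have h4 : Nat.card {x : N // orderOf x = 4} = 90 :=
      (Nat.card_congr (e.toEquiv.subtypeEquiv fun x => by
        rw [← e.orderOf_eq x]; rfl)).trans card_orderOf_eq_four_alternatingGroup_six
    refine eight_le_omegaAut_of_fixedPoints_eq_top N hpi (by rw [hN, h360]; rfl) ?_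
    intro p _ A _ hA hp
    exact hA.fixedPoints_eq_top_of_card_eq_360 hp hN h4
  · have hN : Nat.card N = 168 := (Nat.card_congr e.toEquiv).trans card_PSL_two_zmod_seven
    refine eight_le_omegaAut_of_fixedPoints_eq_top N hpi (by rw [hN, h168]; rfl) ?_
    intro p _ A _ hA hp
    exact hA.fixedPoints_eq_top_of_card hp (.inr (.inl hN))
  · have hN : Nat.card N = 504 :=
      (Nat.card_congr e.toEquiv).trans card_PSL_two_galoisField_eight
    refine eight_le_omegaAut_of_fixedPoints_eq_top N hpi (by rw [hN, h504]; rfl) ?_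
    intro p _ A _ hA hp
    exact hA.fixedPoints_eq_top_of_card hp (.inr (.inr hN))
end
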